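/- Let 0 < r ≤ 1/3. Then 0 and π are attracting fixed points of R_r² modulo 2π with basins (−φ_c, φ_c) and (φ_c, 2π − φ_c) respectively: for every φ ∈ (−φ_c, φ_c) one has R_r^{2m}(φ) − 2mπ → 0 as m → ∞, and for every φ ∈ (φ_c, 2π − φ_c) one has R_r^{2m}(φ) − 2mπ → π as m → ∞. -/

import Mathlib

open Real Filter

/-- The reflection map of the unit circle with light source at `(r,0)`. -/
noncomputable def R (r : ℝ) (φ : ℝ) : ℝ :=
  φ + π - 2 * arctan (r * sin φ / (1 - r * cos φ))

/-- The angle `φ_c ∈ (0,π)` with `cos φ_c = (1 − √(1+8r²))/(4r)`. -/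
noncomputable def φc (r : ℝ) : ℝ :=
  arccos ((1 - Real.sqrt (1 + 8 * r ^ 2)) / (4 * r))

/-- `x`-coordinate of the caustic of `R_r^n`. -/
noncomputable def xc (r : ℝ) (n : ℕ) (φ : ℝ) : ℝ :=
  (deriv ((R r)^[n]) φ * cos φ + cos ((R r)^[n] φ)) / (1 + deriv ((R r)^[n]) φ)

/-- `y`-coordinate of the caustic of `R_r^n`. -/
noncomputable def yc (r : ℝ) (n : ℕ) (φ : ℝ) : ℝ :=
  (deriv ((R r)^[n]) φ * sin φ + sin ((R r)^[n] φ)) / (1 + deriv ((R r)^[n]) φ)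

/-- The quantity `A_n(φ) = −(R_r^n)'(φ) + ((R_r^n)'(φ))³ + 2 (R_r^n)'''(φ)`. -/
noncomputable def A (r : ℝ) (n : ℕ) (φ : ℝ) : ℝ :=
  -(deriv ((R r)^[n]) φ) + (deriv ((R r)^[n]) φ) ^ 3 + 2 * iteratedDeriv 3 ((R r)^[n]) φ

theorem one_sub_mul_cos_pos {r : ℝ} (hr : 0 < r) (hr1 : r < 1) (x : ℝ) : 0 < 1 - r * cos x := by
  nlinarith [cos_le_one x]

theorem sq_norm_one_sub_pos {r : ℝ} (hr : 0 < r) (hr1 : r < 1) (x : ℝ) :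
    0 < 1 - 2 * r * cos x + r ^ 2 := by
  nlinarith [cos_le_one x, sq_pos_of_pos (sub_pos.2 hr1)]

theorem one_add_sq_eq {r : ℝ} (hr : 0 < r) (hr1 : r < 1) (x : ℝ) :
    1 + (r * sin x / (1 - r * cos x)) ^ 2 =
      (1 - 2 * r * cos x + r ^ 2) / (1 - r * cos x) ^ 2 := by
  have hk := (one_sub_mul_cos_pos hr hr1 x).ne'
  field_simp
  linear_combination r ^ 2 * sin_sq_add_cos_sq x

theorem hasDerivAt_R {r : ℝ} (hr : 0 < r) (hr1 : r < 1) (x : ℝ) :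
    HasDerivAt (R r) ((1 - 4 * r * cos x + 3 * r ^ 2) / (1 - 2 * r * cos x + r ^ 2)) x := by
  have hk := (one_sub_mul_cos_pos hr hr1 x).ne'
  have hD := (sq_norm_one_sub_pos hr hr1 x).ne'
  have h := (((hasDerivAt_id x).add_const π).sub
    (((((hasDerivAt_sin x).const_mul r).div
      (((hasDerivAt_cos x).const_mul r).const_sub 1) hk).arctan).const_mul 2))
  refine h.congr_deriv ?_
  rw [Pi.div_apply, one_add_sq_eq hr hr1]
  field_simp
  linear_combination (2 * r ^ 2) * sin_sq_add_cos_sq x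

theorem monotone_R {r : ℝ} (hr : 0 < r) (hr1 : r ≤ 1 / 3) : Monotone (R r) := by
  have h1 : r < 1 := by linarith
  refine monotone_of_deriv_nonneg (fun x => (hasDerivAt_R hr h1 x).differentiableAt) fun x => ?_
  rw [(hasDerivAt_R hr h1 x).deriv]
  refine div_nonneg ?_ (sq_norm_one_sub_pos hr h1 x).le
  nlinarith [cos_le_one x, mul_nonneg (sub_nonneg.2 h1.le) (sub_nonneg.2 hr1)]

theorem continuous_R {r : ℝ} (hr : 0 < r) (hr1 : r < 1) : Continuous (R r) :=
  continuous_iff_continuousAt.2 fun x => (hasDerivAt_R hr hr1 x).continuousAt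

theorem R_add_nat_mul_two_pi (r x : ℝ) (m : ℕ) :
    R r (x + m * (2 * π)) = R r x + m * (2 * π) := by
  simp only [R, sin_add_nat_mul_two_pi, cos_add_nat_mul_two_pi]
  ring

theorem R_neg (r x : ℝ) : R r (-x) = 2 * π - R r x := by
  simp only [R, sin_neg, cos_neg, mul_neg, neg_div, arctan_neg]
  ring

theorem sin_R {r : ℝ} (hr : 0 < r) (hr1 : r < 1) (x : ℝ) :
    sin (R r x) = -(sin x * (1 - 4 * r * cos x + 4 * r ^ 2 * cos x ^ 2 - r ^ 2)) /
      (1 - 2 * r * cos x + r ^ 2) := by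
  have hk := (one_sub_mul_cos_pos hr hr1 x).ne'
  have hD := (sq_norm_one_sub_pos hr hr1 x).ne'
  have hC := cos_sq_arctan (r * sin x / (1 - r * cos x))
  have hS : sin (arctan (r * sin x / (1 - r * cos x))) =
      r * sin x / (1 - r * cos x) * cos (arctan (r * sin x / (1 - r * cos x))) := by
    rw [← tan_mul_cos (cos_arctan_pos _).ne', tan_arctan]
  rw [one_add_sq_eq hr hr1] at hC
  rw [R, add_sub_right_comm, sin_add_pi, sin_sub, sin_two_mul, cos_two_mul, hS,
    show ∀ t c : ℝ, 2 * (t * c) * c = 2 * t * c ^ 2 by intros; ring, hC]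
  field_simp
  ring

theorem cos_R {r : ℝ} (hr : 0 < r) (hr1 : r < 1) (x : ℝ) :
    cos (R r x) = -(cos x - 4 * r * cos x ^ 2 + 2 * r + 4 * r ^ 2 * cos x ^ 3
      - 3 * r ^ 2 * cos x) / (1 - 2 * r * cos x + r ^ 2) := by
  have hk := (one_sub_mul_cos_pos hr hr1 x).ne'
  have hD := (sq_norm_one_sub_pos hr hr1 x).ne'
  have hC := cos_sq_arctan (r * sin x / (1 - r * cos x))
  have hS : sin (arctan (r * sin x / (1 - r * cos x))) =
      r * sin x / (1 - r * cos x) * cos (arctan (r * sin x / (1 - r * cos x))) := by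
    rw [← tan_mul_cos (cos_arctan_pos _).ne', tan_arctan]
  rw [one_add_sq_eq hr hr1] at hC
  rw [R, add_sub_right_comm, cos_add_pi, cos_sub, sin_two_mul, cos_two_mul, hS,
    show ∀ t c : ℝ, 2 * (t * c) * c = 2 * t * c ^ 2 by intros; ring, hC]
  field_simp
  linear_combination (-2 * r * (1 - r * cos x)) / (1 - 2 * r * cos x + r ^ 2) *
    sin_sq_add_cos_sq x - cos x * mul_inv_cancel₀ hD

theorem sum_quotients_eq {r : ℝ} (hr : 0 < r) (hr1 : r < 1) (x : ℝ) :
    r * sin x / (1 - r * cos x) + r * sin (R r x) / (1 - r * cos (R r x)) =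
      4 * r ^ 2 * sin x * (r + cos x - 2 * r * cos x ^ 2) /
        ((1 - 2 * r * cos x + r ^ 2) * (1 - r * cos (R r x))) := by
  have hk := (one_sub_mul_cos_pos hr hr1 x).ne'
  have hD := (sq_norm_one_sub_pos hr hr1 x).ne'
  have hK := (one_sub_mul_cos_pos hr hr1 (R r x)).ne'
  rw [div_add_div _ _ hk hK, div_eq_div_iff (mul_ne_zero hk hK) (mul_ne_zero hD hK)]
  have hs := (eq_div_iff hD).1 (sin_R hr hr1 x)
  have hc := (eq_div_iff hD).1 (cos_R hr hr1 x)
  linear_combination (1 - r * cos (R r x)) * (r * (1 - r * cos x)) * hs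
    - (1 - r * cos (R r x)) * r * sin x * r * hc

theorem R_R_sub (r x : ℝ) : R r (R r x) - 2 * π = x - 2 *
    (arctan (r * sin x / (1 - r * cos x)) +
      arctan (r * sin (R r x) / (1 - r * cos (R r x)))) := by
  rw [R.eq_1 r (R r x)]
  nth_rewrite 1 [R.eq_1 r x]
  ring

theorem R_R_lt {r : ℝ} (hr : 0 < r) (hr1 : r < 1) {x : ℝ} (hs : 0 < sin x)
    (hq : 0 < r + cos x - 2 * r * cos x ^ 2) : R r (R r x) - 2 * π < x := by
  have hD := sq_norm_one_sub_pos hr hr1 x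
  have hK := one_sub_mul_cos_pos hr hr1 (R r x)
  have h := sum_quotients_eq hr hr1 x
  have h' : 0 < 4 * r ^ 2 * sin x * (r + cos x - 2 * r * cos x ^ 2) /
        ((1 - 2 * r * cos x + r ^ 2) * (1 - r * cos (R r x))) := by positivity
  rw [← h, ← neg_lt_iff_pos_add, ← arctan_strictMono.lt_iff_lt, arctan_neg] at h'
  rw [R_R_sub]
  linarith

theorem lt_R_R {r : ℝ} (hr : 0 < r) (hr1 : r < 1) {x : ℝ} (hs : 0 < sin x)
    (hq : r + cos x - 2 * r * cos x ^ 2 < 0) : x < R r (R r x) - 2 * π := by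
  have hD := sq_norm_one_sub_pos hr hr1 x
  have hK := one_sub_mul_cos_pos hr hr1 (R r x)
  have h := sum_quotients_eq hr hr1 x
  have h' : 4 * r ^ 2 * sin x * (r + cos x - 2 * r * cos x ^ 2) /
        ((1 - 2 * r * cos x + r ^ 2) * (1 - r * cos (R r x))) < 0 :=
    div_neg_of_neg_of_pos (mul_neg_of_pos_of_neg (by positivity) hq) (by positivity)
  rw [← h, ← lt_neg_iff_add_neg, ← arctan_strictMono.lt_iff_lt, arctan_neg] at h'
  rw [R_R_sub]
  linarith

theorem quadratic_factor {r : ℝ} (hr : 0 < r) (c : ℝ) :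
    r + c - 2 * r * c ^ 2 = 2 * r * (c - (1 - √(1 + 8 * r ^ 2)) / (4 * r)) *
      ((1 + √(1 + 8 * r ^ 2)) / (4 * r) - c) := by
  have h : √(1 + 8 * r ^ 2) ^ 2 = 1 + 8 * r ^ 2 := sq_sqrt (by positivity)
  generalize √(1 + 8 * r ^ 2) = s at h ⊢
  field_simp
  linear_combination (-2) * h

theorem cos_φc {r : ℝ} (hr : 0 < r) :
    cos (φc r) = (1 - √(1 + 8 * r ^ 2)) / (4 * r) := by
  have h1 : √(1 + 8 * r ^ 2) ≤ 1 + 4 * r := sqrt_le_iff.2 ⟨by positivity, by nlinarith⟩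
  have h0 := sqrt_nonneg (1 + 8 * r ^ 2)
  have h2 : 1 ≤ √(1 + 8 * r ^ 2) := one_le_sqrt.2 (by nlinarith)
  refine cos_arccos ?_ ?_
  · rw [le_div_iff₀ (by positivity)]; linarith
  · rw [div_le_iff₀ (by positivity)]; linarith

theorem cos_lt_larger_root {r : ℝ} (hr : 0 < r) (hr1 : r < 1) (x : ℝ) :
    cos x < (1 + √(1 + 8 * r ^ 2)) / (4 * r) := by
  refine (cos_le_one x).trans_lt ?_
  rw [lt_div_iff₀ (by positivity)]
  have h1 : 1 ≤ √(1 + 8 * r ^ 2) := one_le_sqrt.2 (by nlinarith)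
  have h2 : 4 * r - 1 < √(1 + 8 * r ^ 2) := by
    refine lt_sqrt_of_sq_lt ?_
    nlinarith
  linarith

theorem R_R_lt_of_mem_Ioo {r : ℝ} (hr : 0 < r) (hr1 : r < 1) {x : ℝ}
    (hx : x ∈ Set.Ioo 0 (φc r)) : R r (R r x) - 2 * π < x := by
  have hπ : φc r ≤ π := arccos_le_pi _
  have hc := cos_lt_cos_of_nonneg_of_le_pi hx.1.le hπ hx.2
  refine R_R_lt hr hr1 (sin_pos_of_pos_of_lt_pi hx.1 (hx.2.trans_le hπ)) ?_
  rw [quadratic_factor hr, ← cos_φc hr]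
  exact mul_pos (mul_pos (by positivity) (sub_pos.2 hc))
    (sub_pos.2 (cos_lt_larger_root hr hr1 x))

theorem lt_R_R_of_mem_Ioo {r : ℝ} (hr : 0 < r) (hr1 : r < 1) {x : ℝ}
    (hx : x ∈ Set.Ioo (φc r) π) : x < R r (R r x) - 2 * π := by
  have h0 : 0 ≤ φc r := arccos_nonneg _
  have hc := cos_lt_cos_of_nonneg_of_le_pi h0 hx.2.le hx.1
  refine lt_R_R hr hr1 (sin_pos_of_pos_of_lt_pi (h0.trans_lt hx.1) hx.2) ?_
  rw [quadratic_factor hr, ← cos_φc hr]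
  exact mul_neg_of_neg_of_pos (mul_neg_of_pos_of_neg (by positivity) (sub_neg.2 hc))
    (sub_pos.2 (cos_lt_larger_root hr hr1 x))

theorem tendsto_of_contracting_to_left {f : ℝ → ℝ} (hf : Continuous f) {a b : ℝ}
    (ha : f a = a) (hle : ∀ x ∈ Set.Ioo a b, a ≤ f x) (hlt : ∀ x ∈ Set.Ioo a b, f x < x)
    {u : ℕ → ℝ} (hu : ∀ n, u (n + 1) = f (u n)) (h0 : u 0 ∈ Set.Ico a b) :
    Tendsto u atTop (nhds a) := by
  have hstep : ∀ x ∈ Set.Ico a b, a ≤ f x ∧ f x ≤ x := fun x hx => by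
    rcases hx.1.eq_or_lt with rfl | h
    · exact ⟨ha.ge, ha.le⟩
    · exact ⟨hle x ⟨h, hx.2⟩, (hlt x ⟨h, hx.2⟩).le⟩
  have hmem : ∀ n, u n ∈ Set.Ico a b := fun n => by
    induction n with
    | zero => exact h0
    | succ n ih => exact hu n ▸ ⟨(hstep _ ih).1, (hstep _ ih).2.trans_lt ih.2⟩
  have hanti : Antitone u := antitone_nat_of_succ_le fun n => hu n ▸ (hstep _ (hmem n)).2
  have hlim := tendsto_atTop_ciInf hanti ⟨a, by rintro _ ⟨n, rfl⟩; exact (hmem n).1⟩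
  set l := ⨅ n, u n
  have hal : a ≤ l := ge_of_tendsto' hlim fun n => (hmem n).1
  have hlb : l < b := (hanti.le_of_tendsto hlim 0).trans_lt h0.2
  have hfix : f l = l := by
    refine tendsto_nhds_unique ((hf.tendsto l).comp hlim) ?_
    simpa only [Function.comp_def, ← hu] using (tendsto_add_atTop_iff_nat 1).2 hlim
  rcases hal.eq_or_lt with h | h
  · rwa [h]
  · exact absurd hfix (hlt l ⟨h, hlb⟩).ne

theorem R_iterate_succ (r φ : ℝ) (m : ℕ) :
    (R r)^[2 * (m + 1)] φ - 2 * (m + 1 : ℕ) * π =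
      R r (R r ((R r)^[2 * m] φ - 2 * m * π)) - 2 * π := by
  obtain ⟨y, hy⟩ : ∃ y, (R r)^[2 * m] φ = y + m * (2 * π) := ⟨_, (sub_add_cancel _ _).symm⟩
  rw [mul_add, mul_one, Function.iterate_succ_apply', Function.iterate_succ_apply', hy,
    R_add_nat_mul_two_pi, R_add_nat_mul_two_pi,
    show y + m * (2 * π) - 2 * m * π = y by ring]
  push_cast
  ring

theorem R_zero (r : ℝ) : R r 0 = π := by simp [R]

theorem R_pi (r : ℝ) : R r π = 2 * π := by simp [R]; ring

theorem R_two_pi_add (r x : ℝ) : R r (2 * π + x) = R r x + 2 * π := by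
  simpa [add_comm] using R_add_nat_mul_two_pi r x 1

theorem R_two_pi_sub (r x : ℝ) : R r (2 * π - x) = 4 * π - R r x := by
  rw [sub_eq_add_neg, R_two_pi_add, R_neg]
  ring

theorem R_R_neg (r x : ℝ) : R r (R r (-x)) - 2 * π = -(R r (R r x) - 2 * π) := by
  rw [R_neg, R_two_pi_sub]
  ring

theorem R_R_two_pi_sub (r x : ℝ) :
    R r (R r (2 * π - x)) - 2 * π = 2 * π - (R r (R r x) - 2 * π) := by
  rw [R_two_pi_sub, show 4 * π - R r x = 2 * π + (2 * π - R r x) by ring, R_two_pi_add,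
    R_two_pi_sub]
  ring

theorem tendsto_zero_of_mem_Ico {r : ℝ} (hr : 0 < r) (hr1 : r ≤ 1 / 3) {u : ℕ → ℝ}
    (hu : ∀ n, u (n + 1) = R r (R r (u n)) - 2 * π) (h0 : u 0 ∈ Set.Ico 0 (φc r)) :
    Tendsto u atTop (nhds 0) := by
  have h1 : r < 1 := by linarith
  have hcont := continuous_R hr h1
  have hfix : R r (R r 0) - 2 * π = 0 := by rw [R_zero, R_pi, sub_self]
  have hmono := monotone_R hr hr1
  refine tendsto_of_contracting_to_left (f := fun x => R r (R r x) - 2 * π) (by fun_prop)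
    hfix (fun x hx => ?_) (fun x hx => R_R_lt_of_mem_Ioo hr h1 hx) hu h0
  have := hmono (hmono hx.1.le)
  linarith

theorem tendsto_pi_of_mem_Ioc {r : ℝ} (hr : 0 < r) (hr1 : r ≤ 1 / 3) {u : ℕ → ℝ}
    (hu : ∀ n, u (n + 1) = R r (R r (u n)) - 2 * π) (h0 : u 0 ∈ Set.Ioc (φc r) π) :
    Tendsto u atTop (nhds π) := by
  have h1 : r < 1 := by linarith
  have hcont := continuous_R hr h1
  have hfix : R r (R r π) - 2 * π = π := by
    have := R_two_pi_add r 0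
    rw [add_zero, R_zero] at this
    rw [R_pi, this]
    ring
  have hmono := monotone_R hr hr1
  have key : Tendsto (fun n => -u n) atTop (nhds (-π)) := by
    refine tendsto_of_contracting_to_left (f := fun x => -(R r (R r (-x)) - 2 * π))
      (b := -φc r) (by fun_prop) (by rw [neg_neg, hfix]) (fun x hx => ?_) (fun x hx => ?_)
      (fun n => by rw [neg_neg, hu]) ⟨neg_le_neg h0.2, neg_lt_neg h0.1⟩
    · have := hmono (hmono (neg_lt.1 hx.1).le)
      linarith
    · exact neg_lt.1 (lt_R_R_of_mem_Ioo hr h1 ⟨lt_neg.1 hx.2, neg_lt.1 hx.1⟩)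
  simpa using key.neg

theorem stmt_17 (r : ℝ) (hr : 0 < r) (hr1 : r ≤ 1 / 3) :
    (∀ φ ∈ Set.Ioo (-(φc r)) (φc r),
      Tendsto (fun m : ℕ => (R r)^[2 * m] φ - 2 * m * π) atTop (nhds 0)) ∧
    (∀ φ ∈ Set.Ioo (φc r) (2 * π - φc r),
      Tendsto (fun m : ℕ => (R r)^[2 * m] φ - 2 * m * π) atTop (nhds π)) := by
  constructor
  · intro φ hφ
    rcases le_total 0 φ with h | h
    · exact tendsto_zero_of_mem_Ico hr hr1 (R_iterate_succ r φ) (by simpa using ⟨h, hφ.2⟩)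
    · have key := tendsto_zero_of_mem_Ico hr hr1
        (u := fun m : ℕ => -((R r)^[2 * m] φ - 2 * m * π))
        (fun m => by rw [R_iterate_succ, R_R_neg])
        (by simpa using ⟨h, neg_lt.1 hφ.1⟩)
      simpa using key.neg
  · intro φ hφ
    rcases le_total φ π with h | h
    · exact tendsto_pi_of_mem_Ioc hr hr1 (R_iterate_succ r φ) (by simpa using ⟨hφ.1, h⟩)
    · have key := tendsto_pi_of_mem_Ioc hr hr1
        (u := fun m : ℕ => 2 * π - ((R r)^[2 * m] φ - 2 * m * π))
        (fun m => by rw [R_iterate_succ, R_R_two_pi_sub])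
        (by
          have := hφ.2
          simp only [mul_zero, Function.iterate_zero, id_eq, Nat.cast_zero, zero_mul, sub_zero]
          constructor <;> linarith)
      have := key.const_sub (2 * π)
      simpa only [sub_sub_cancel, show 2 * π - π = π by ring] using this
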